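/- Let R and B be disjoint finite sets of points in the plane and let L be a line containing exactly r points of R and exactly b points of B. Set r' = min{|R \ L|, b} and b' = min{|B \ L|, r}. Then R ∪ B determines at least b·r' - r'(r'-1)/2 + r·b' - b'(b'-1)/2 bichromatic lines; moreover, if L is itself bichromatic (r ≥ 1 and b ≥ 1), then R ∪ B determines at least b·r' - r'(r'-1)/2 + r·b' - b'(b'-1)/2 + 1 bichromatic lines. -/

import Mathlib

open scoped Classical

noncomputable section

/-- A line in the plane: the affine span of two distinct points. -/
def IsLine (L : Set (ℝ × ℝ)) : Prop :=
  ∃ p q : ℝ × ℝ, p ≠ q ∧ L = (affineSpan ℝ ({p, q} : Set (ℝ × ℝ)) : Set (ℝ × ℝ))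

/-- The points of the finite set `P` lying on `L`. -/
def ptsOn (P : Finset (ℝ × ℝ)) (L : Set (ℝ × ℝ)) : Finset (ℝ × ℝ) :=
  P.filter (fun x => x ∈ L)

/-- A line determined by `P`: contains at least two points of `P`. -/
def DeterminedLine (P : Finset (ℝ × ℝ)) (L : Set (ℝ × ℝ)) : Prop :=
  IsLine L ∧ 2 ≤ (ptsOn P L).card

/-- A bichromatic line: determined by `R ∪ B`, with at least one red and one blue point. -/
def BichromaticLine (R B : Finset (ℝ × ℝ)) (L : Set (ℝ × ℝ)) : Prop :=
  DeterminedLine (R ∪ B) L ∧ (∃ p ∈ R, p ∈ L) ∧ (∃ p ∈ B, p ∈ L)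

/-- The number of bichromatic lines determined by `R ∪ B`. -/
def nBichromatic (R B : Finset (ℝ × ℝ)) : ℕ :=
  {L : Set (ℝ × ℝ) | BichromaticLine R B L}.ncard

/-- A near-pencil: some line contains all but exactly one of the points of `P`. -/
def NearPencil (P : Finset (ℝ × ℝ)) : Prop :=
  ∃ L : Set (ℝ × ℝ), IsLine L ∧ (ptsOn P L).card = P.card - 1

/-- The line through `p` and `q`, as a set of points. -/
def lineThrough (p q : ℝ × ℝ) : Set (ℝ × ℝ) :=
  (affineSpan ℝ ({p, q} : Set (ℝ × ℝ)) : Set (ℝ × ℝ))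

theorem left_mem_lineThrough (p q : ℝ × ℝ) : p ∈ lineThrough p q :=
  left_mem_affineSpan_pair ℝ p q

theorem right_mem_lineThrough (p q : ℝ × ℝ) : q ∈ lineThrough p q :=
  right_mem_affineSpan_pair ℝ p q

theorem isLine_lineThrough {p q : ℝ × ℝ} (h : p ≠ q) : IsLine (lineThrough p q) :=
  ⟨p, q, h, rfl⟩

theorem IsLine.eq_lineThrough {L : Set (ℝ × ℝ)} (hL : IsLine L) {x y : ℝ × ℝ}
    (hx : x ∈ L) (hy : y ∈ L) (hxy : x ≠ y) : L = lineThrough x y := by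
  obtain ⟨p, q, -, rfl⟩ := hL
  rw [SetLike.mem_coe, mem_affineSpan_pair_iff_exists_lineMap_eq] at hx hy
  obtain ⟨s, rfl⟩ := hx
  obtain ⟨t, rfl⟩ := hy
  have hst : t - s ≠ 0 := fun h => hxy (by rw [sub_eq_zero.mp h])
  refine Set.Subset.antisymm ?_ ?_
  · refine SetLike.coe_subset_coe.mpr (affineSpan_le.mpr ?_)
    rintro z (rfl | rfl) <;> rw [SetLike.mem_coe, mem_affineSpan_pair_iff_exists_lineMap_eq]
    · refine ⟨-s / (t - s), ?_⟩
      ext <;> simp [AffineMap.lineMap_apply] <;> field_simp <;> ring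
    · refine ⟨(1 - s) / (t - s), ?_⟩
      ext <;> simp [AffineMap.lineMap_apply] <;> field_simp <;> ring
  · refine SetLike.coe_subset_coe.mpr (affineSpan_le.mpr ?_)
    rintro z (rfl | rfl) <;> exact AffineMap.lineMap_mem_affineSpan_pair _ _ _

theorem IsLine.eq_of_mem {L M : Set (ℝ × ℝ)} (hL : IsLine L) (hM : IsLine M) {x y : ℝ × ℝ}
    (hxy : x ≠ y) (hxL : x ∈ L) (hyL : y ∈ L) (hxM : x ∈ M) (hyM : y ∈ M) : L = M :=
  (hL.eq_lineThrough hxL hyL hxy).trans (hM.eq_lineThrough hxM hyM hxy).symm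

/-- The lines joining a point of `P` to a point of `Q`. -/
def joins (P Q : Finset (ℝ × ℝ)) : Finset (Set (ℝ × ℝ)) :=
  (P ×ˢ Q).image fun x => lineThrough x.1 x.2

theorem mem_joins {P Q : Finset (ℝ × ℝ)} {M : Set (ℝ × ℝ)} :
    M ∈ joins P Q ↔ ∃ p ∈ P, ∃ q ∈ Q, lineThrough p q = M := by
  simp [joins, and_assoc]

theorem joins_mono_left {P P' Q : Finset (ℝ × ℝ)} (h : P ⊆ P') : joins P Q ⊆ joins P' Q :=
  Finset.image_subset_image (Finset.product_subset_product_left h)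

/-- A line through a point off `L` meets `L` in at most one point. -/
theorem IsLine.eq_of_mem_lineThrough {L : Set (ℝ × ℝ)} (hL : IsLine L) {p q x : ℝ × ℝ}
    (hp : p ∉ L) (hq : q ∈ L) (hx : x ∈ L) (hxpq : x ∈ lineThrough p q) : x = q := by
  by_contra hne
  have hpq : p ≠ q := fun h => hp (h ▸ hq)
  exact hp (hL.eq_of_mem (isLine_lineThrough hpq) hne hx hq hxpq
    (right_mem_lineThrough p q) ▸ left_mem_lineThrough p q)

/-- Adding a point off `L` to `P` creates at least `|Q| - |P|` new joining lines. -/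
theorem card_joins_insert {L : Set (ℝ × ℝ)} (hL : IsLine L) {P Q : Finset (ℝ × ℝ)}
    {p : ℝ × ℝ} (hpP : p ∉ P) (hp : p ∉ L) (hP : ∀ x ∈ P, x ∉ L) (hQ : ∀ q ∈ Q, q ∈ L) :
    (joins P Q).card + Q.card ≤ (joins (insert p P) Q).card + P.card := by
  have hne : ∀ x ∉ L, ∀ q ∈ Q, x ≠ q := fun x hx q hq h => hx (h ▸ hQ q hq)
  have hinj : Set.InjOn (lineThrough p) (Q : Set (ℝ × ℝ)) := fun q₁ h₁ q₂ h₂ h =>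
    hL.eq_of_mem_lineThrough hp (hQ _ h₂) (hQ _ h₁) (h ▸ right_mem_lineThrough p q₁)
  set new := Q.image (lineThrough p)
  have hnewcard : new.card = Q.card := Finset.card_image_of_injOn hinj
  have hunion : joins P Q ∪ new ⊆ joins (insert p P) Q := by
    refine Finset.union_subset (joins_mono_left (Finset.subset_insert p P)) fun M hM => ?_
    obtain ⟨q, hq, rfl⟩ := Finset.mem_image.mp hM
    exact mem_joins.mpr ⟨p, Finset.mem_insert_self p P, q, hq, rfl⟩
  have hinter : (joins P Q ∩ new).card ≤ P.card := by
    refine (Finset.card_le_card fun M hM => ?_).trans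
      (Finset.card_image_le (s := P) (f := lineThrough p))
    obtain ⟨hM₁, hM₂⟩ := Finset.mem_inter.mp hM
    obtain ⟨x, hx, y, hy, rfl⟩ := mem_joins.mp hM₁
    obtain ⟨q, hq, hM⟩ := Finset.mem_image.mp hM₂
    refine Finset.mem_image.mpr ⟨x, hx, ?_⟩
    refine ((isLine_lineThrough (hne x (hP x hx) y hy)).eq_lineThrough ?_
      (left_mem_lineThrough x y) ?_).symm
    · exact hM ▸ left_mem_lineThrough p q
    · rintro rfl
      exact hpP hx
  have := Finset.card_union_add_card_inter (joins P Q) new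
  have := Finset.card_le_card hunion
  omega

theorem card_joins_lower_bound {L : Set (ℝ × ℝ)} (hL : IsLine L) {P Q : Finset (ℝ × ℝ)}
    (hP : ∀ x ∈ P, x ∉ L) (hQ : ∀ q ∈ Q, q ∈ L) :
    (Q.card * P.card : ℤ) - P.card * (P.card - 1) / 2 ≤ (joins P Q).card := by
  suffices h : (2 * (Q.card * P.card) : ℤ) - P.card * (P.card - 1) ≤ 2 * (joins P Q).card by
    have := Int.even_mul_pred_self (P.card : ℤ)
    rw [even_iff_two_dvd] at this
    omega
  induction P using Finset.induction_on with
  | empty => simp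
  | insert p P hpP ih =>
    have ih := ih fun x hx => hP x (Finset.mem_insert_of_mem hx)
    have := card_joins_insert hL hpP (hP p (Finset.mem_insert_self p P))
      (fun x hx => hP x (Finset.mem_insert_of_mem hx)) hQ
    rw [Finset.card_insert_of_notMem hpP]
    zify at this
    push_cast
    linarith

theorem card_joins_lower_bound_min {L : Set (ℝ × ℝ)} (hL : IsLine L) {P Q : Finset (ℝ × ℝ)}
    (hP : ∀ x ∈ P, x ∉ L) (hQ : ∀ q ∈ Q, q ∈ L) {n : ℕ} (hn : n ≤ P.card) :
    (Q.card * n : ℤ) - n * (n - 1) / 2 ≤ (joins P Q).card := by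
  obtain ⟨S, hSP, rfl⟩ := Finset.exists_subset_card_eq hn
  refine (card_joins_lower_bound hL (fun x hx => hP x (hSP hx)) hQ).trans ?_
  exact_mod_cast Finset.card_le_card (joins_mono_left hSP)

theorem bichromaticLine_of_mem {R B : Finset (ℝ × ℝ)} (hRB : Disjoint R B) {L : Set (ℝ × ℝ)}
    (hL : IsLine L) {p q : ℝ × ℝ} (hp : p ∈ R) (hq : q ∈ B) (hpL : p ∈ L) (hqL : q ∈ L) :
    BichromaticLine R B L := by
  refine ⟨⟨hL, Finset.one_lt_card.mpr ⟨p, ?_, q, ?_, ?_⟩⟩, ⟨p, hp, hpL⟩, ⟨q, hq, hqL⟩⟩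
  · simp [ptsOn, hp, hpL]
  · simp [ptsOn, hq, hqL]
  · exact Finset.disjoint_iff_ne.mp hRB p hp q hq

theorem finite_setOf_bichromaticLine {R B : Finset (ℝ × ℝ)} (hRB : Disjoint R B) :
    {L : Set (ℝ × ℝ) | BichromaticLine R B L}.Finite := by
  refine (joins R B).finite_toSet.subset ?_
  rintro M ⟨⟨hM, -⟩, ⟨p, hp, hpM⟩, ⟨q, hq, hqM⟩⟩
  exact mem_joins.mpr ⟨p, hp, q, hq,
    (hM.eq_lineThrough hpM hqM (Finset.disjoint_iff_ne.mp hRB p hp q hq)).symm⟩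

theorem card_le_nBichromatic {R B : Finset (ℝ × ℝ)} (hRB : Disjoint R B)
    {S : Finset (Set (ℝ × ℝ))} (hS : ∀ M ∈ S, BichromaticLine R B M) :
    S.card ≤ nBichromatic R B := by
  rw [← Set.ncard_coe_finset]
  exact Set.ncard_le_ncard hS (finite_setOf_bichromaticLine hRB)

/-- **Lemma 2.1.** If a line `L` contains `r` red and `b` blue points, then with
`r' = min {|R \ L|, b}` and `b' = min {|B \ L|, r}`, the number of bichromatic lines
is at least `b·r' - r'(r'-1)/2 + r·b' - b'(b'-1)/2`, plus one more if `L` is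
itself bichromatic. -/
theorem bichromatic_count_from_line
    (R B : Finset (ℝ × ℝ)) (hRB : Disjoint R B)
    (L : Set (ℝ × ℝ)) (hL : IsLine L) (r b r' b' : ℕ)
    (hr : (ptsOn R L).card = r) (hb : (ptsOn B L).card = b)
    (hr' : r' = min (R.filter (fun x => x ∉ L)).card b)
    (hb' : b' = min (B.filter (fun x => x ∉ L)).card r) :
    ((b * r' : ℤ) - r' * (r' - 1) / 2 + r * b' - b' * (b' - 1) / 2
        ≤ (nBichromatic R B : ℤ)) ∧
    (1 ≤ r → 1 ≤ b →
      (b * r' : ℤ) - r' * (r' - 1) / 2 + r * b' - b' * (b' - 1) / 2 + 1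
        ≤ (nBichromatic R B : ℤ)) := by
  set X := joins (R.filter (fun x => x ∉ L)) (ptsOn B L)
  set Y := joins (B.filter (fun x => x ∉ L)) (ptsOn R L)
  have hXcard : (b * r' : ℤ) - r' * (r' - 1) / 2 ≤ X.card := by
    rw [← hb]
    exact card_joins_lower_bound_min hL (fun x hx => (Finset.mem_filter.mp hx).2)
      (fun q hq => (Finset.mem_filter.mp hq).2) (hr'.trans_le (min_le_left _ _))
  have hYcard : (r * b' : ℤ) - b' * (b' - 1) / 2 ≤ Y.card := by
    rw [← hr]
    exact card_joins_lower_bound_min hL (fun x hx => (Finset.mem_filter.mp hx).2)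
      (fun q hq => (Finset.mem_filter.mp hq).2) (hb'.trans_le (min_le_left _ _))
  have hne : ∀ {p q : ℝ × ℝ}, p ∉ L → q ∈ L → p ≠ q := fun hp hq h => hp (h ▸ hq)
  have hXY : Disjoint X Y := by
    refine Finset.disjoint_left.mpr fun M hMX hMY => ?_
    obtain ⟨p, hp, q, hq, rfl⟩ := mem_joins.mp hMX
    obtain ⟨p₂, hp₂, q₂, hq₂, hM⟩ := mem_joins.mp hMY
    simp only [ptsOn, Finset.mem_filter] at hp hq hp₂ hq₂
    exact Finset.disjoint_iff_ne.mp hRB q₂ hq₂.1 q hq.1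
      (hL.eq_of_mem_lineThrough hp.2 hq.2 hq₂.2 (hM ▸ right_mem_lineThrough p₂ q₂))
  have hbi : ∀ M ∈ X ∪ Y, BichromaticLine R B M := by
    intro M hM
    rcases Finset.mem_union.mp hM with hM | hM <;>
      obtain ⟨p, hp, q, hq, rfl⟩ := mem_joins.mp hM <;>
      simp only [ptsOn, Finset.mem_filter] at hp hq
    · exact bichromaticLine_of_mem hRB (isLine_lineThrough (hne hp.2 hq.2)) hp.1 hq.1
        (left_mem_lineThrough p q) (right_mem_lineThrough p q)
    · exact bichromaticLine_of_mem hRB (isLine_lineThrough (hne hp.2 hq.2)) hq.1 hp.1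
        (right_mem_lineThrough p q) (left_mem_lineThrough p q)
  have hcard : (X ∪ Y).card = X.card + Y.card := Finset.card_union_of_disjoint hXY
  refine ⟨?_, fun h1r h1b => ?_⟩
  · have := card_le_nBichromatic hRB hbi
    omega
  · have hLXY : L ∉ X ∪ Y := by
      intro hM
      rcases Finset.mem_union.mp hM with hM | hM <;>
        obtain ⟨p, hp, q, -, h⟩ := mem_joins.mp hM <;>
        exact (Finset.mem_filter.mp hp).2 (h ▸ left_mem_lineThrough p q)
    have hLbi : BichromaticLine R B L := by
      obtain ⟨p, hp⟩ := Finset.card_pos.mp (hr ▸ h1r)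
      obtain ⟨q, hq⟩ := Finset.card_pos.mp (hb ▸ h1b)
      simp only [ptsOn, Finset.mem_filter] at hp hq
      exact bichromaticLine_of_mem hRB hL hp.1 hq.1 hp.2 hq.2
    have := card_le_nBichromatic hRB (S := insert L (X ∪ Y))
      (Finset.forall_mem_insert _ _ _ |>.mpr ⟨hLbi, hbi⟩)
    rw [Finset.card_insert_of_notMem hLXY] at this
    omega
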